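/- arXiv:2301.08870 — 3 statements merged into one kernel-verified Lean document; each statement's English description precedes it below -/
import Mathlib

section
/- Let G be a finite abelian group and let n be an odd positive integer. For every cycle C in degree n of the unnormalized bar complex of G with trivial ℤ-coefficients (i.e. C ∈ C_n(G) with dC = 0), there exist a positive integer r and a chain u ∈ C_{n+1}(G) such that d u = r • C − (r · ε(C)) • e_n, where ε(C) is the sum of the coefficients of C and e_n is the basis element [1|1|⋯|1]. -/
/-- The differential of the unnormalized bar complex (inhomogeneous chains) of a group `G`
with trivial `ℤ`-coefficients, from degree `n + 1` to degree `n`: it sends the basis element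
`[g₁|⋯|g_{n+1}]` to
`[g₂|⋯|g_{n+1}] + ∑_{i=1}^{n} (−1)^i [g₁|⋯|g_i g_{i+1}|⋯|g_{n+1}] + (−1)^{n+1} [g₁|⋯|g_n]`. -/
noncomputable def barD (G : Type*) [Group G] (n : ℕ) :
    ((Fin (n + 1) → G) →₀ ℤ) →ₗ[ℤ] ((Fin n → G) →₀ ℤ) :=
  Finsupp.lsum ℤ fun g =>
    LinearMap.toSpanSingleton ℤ ((Fin n → G) →₀ ℤ)
      (Finsupp.single (fun i => g i.succ) 1
        + ∑ j : Fin (n + 1), ((-1 : ℤ) ^ ((j : ℕ) + 1)) •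
            Finsupp.single (j.contractNth (· * ·) g) 1)

/-- The sum of the coefficients of a chain. -/
def barEps {G : Type*} [Group G] {n : ℕ} (x : (Fin n → G) →₀ ℤ) : ℤ :=
  x.sum fun _ c => c

/-- The basis element `[1|1|⋯|1]` of the degree-`n` term of the bar complex. -/
noncomputable def barOne (G : Type*) [Group G] (n : ℕ) : (Fin n → G) →₀ ℤ :=
  Finsupp.single (fun _ => (1 : G)) 1

theorem barD_single_aux (G : Type*) [Group G] (n : ℕ) (g : Fin (n + 1) → G) :
    barD G n (Finsupp.single g 1) = Finsupp.single (fun i => g i.succ) 1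
        + ∑ j : Fin (n + 1), ((-1 : ℤ) ^ ((j : ℕ) + 1)) •
            Finsupp.single (j.contractNth (· * ·) g) 1 := by
  simp [barD]

/-- The averaging contraction `[g₁|⋯|g_n] ↦ ∑_h [h|g₁|⋯|g_n]`. -/
noncomputable def barS (G : Type*) [Group G] [Fintype G] (n : ℕ) :
    ((Fin n → G) →₀ ℤ) →ₗ[ℤ] ((Fin (n + 1) → G) →₀ ℤ) :=
  Finsupp.lsum ℤ fun g =>
    LinearMap.toSpanSingleton ℤ ((Fin (n + 1) → G) →₀ ℤ)
      (∑ h : G, Finsupp.single (Fin.cons h g : Fin (n + 1) → G) 1)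

theorem barS_single_aux (G : Type*) [Group G] [Fintype G] (n : ℕ) (g : Fin n → G) :
    barS G n (Finsupp.single g 1) =
      ∑ h : G, Finsupp.single (Fin.cons h g : Fin (n + 1) → G) 1 := by
  simp [barS]

theorem contract_zero_aux {G : Type*} [Group G] {n : ℕ} (h : G) (g : Fin (n + 1) → G) :
    (0 : Fin (n + 2)).contractNth (· * ·) (Fin.cons h g : Fin (n + 2) → G)
      = Fin.cons (h * g 0) (fun i => g i.succ) := by
  funext k
  refine Fin.cases ?_ (fun k => ?_) k
  · simp [Fin.contractNth]
  · simp [Fin.contractNth]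

theorem contract_succ_aux {G : Type*} [Group G] {n : ℕ} (h : G) (g : Fin (n + 1) → G)
    (j : Fin (n + 1)) :
    j.succ.contractNth (· * ·) (Fin.cons h g : Fin (n + 2) → G)
      = Fin.cons h (j.contractNth (· * ·) g) := by
  funext k
  refine Fin.cases ?_ (fun k => ?_) k
  · simp [Fin.contractNth]
  · simp [Fin.contractNth]

theorem bar_homotopy_aux (G : Type*) [Group G] [Fintype G] (m : ℕ)
    (C : (Fin (m + 1) → G) →₀ ℤ) :
    barD G (m + 1) (barS G (m + 1) C) + barS G m (barD G m C) = (Fintype.card G : ℤ) • C := by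
  suffices H : barD G (m + 1) ∘ₗ barS G (m + 1) + barS G m ∘ₗ barD G m
      = (Fintype.card G : ℤ) • LinearMap.id from LinearMap.congr_fun H C
  refine Finsupp.lhom_ext' fun g => LinearMap.ext_ring ?_
  simp only [LinearMap.comp_apply, LinearMap.add_apply, LinearMap.smul_apply, LinearMap.id_apply,
    Finsupp.lsingle_apply, barS_single_aux, barD_single_aux, map_sum, map_add, map_smul]
  have key : ∀ h : G, (∑ j : Fin (m + 1 + 1), ((-1 : ℤ) ^ ((j : ℕ) + 1)) •
      Finsupp.single (j.contractNth (· * ·) (Fin.cons h g : Fin (m + 2) → G)) (1 : ℤ))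
      = - Finsupp.single (Fin.cons (h * g 0) (fun i => g i.succ) : Fin (m + 1) → G) (1 : ℤ)
        - ∑ j : Fin (m + 1), ((-1 : ℤ) ^ ((j : ℕ) + 1)) •
          Finsupp.single (Fin.cons h (j.contractNth (· * ·) g) : Fin (m + 1) → G) (1 : ℤ) := by
    intro h
    rw [Fin.sum_univ_succ, contract_zero_aux]
    simp only [contract_succ_aux, Fin.val_succ, pow_succ _ (_ + 1), mul_neg_one, neg_smul,
      Finset.sum_neg_distrib]
    simp [sub_eq_add_neg]
  simp only [key, Finset.sum_add_distrib, Finset.sum_sub_distrib, Finset.sum_neg_distrib,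
    Fin.cons_succ, Finset.smul_sum]
  have e : (∑ h : G, Finsupp.single (Fin.cons (h * g 0) (fun i => g i.succ) : Fin (m + 1) → G)
      (1 : ℤ)) = ∑ h : G, Finsupp.single (Fin.cons h (fun i => g i.succ) : Fin (m + 1) → G) 1 :=
    Fintype.sum_equiv (Equiv.mulRight (g 0)) _ _ fun _ => rfl
  rw [e, Finset.sum_comm (s := (Finset.univ : Finset (Fin (m + 1))))]
  simp
  abel

theorem barD_one_aux (G : Type*) [Group G] (n : ℕ) (hn : Odd n) :
    barD G n (barOne G (n + 1)) = barOne G n := by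
  have c : ∀ j : Fin (n + 1), j.contractNth (· * ·) (fun _ => (1 : G)) = fun _ => 1 := by
    intro j
    funext k
    simp [Fin.contractNth]
  have z : ∑ j : Fin (n + 1), (-1 : ℤ) ^ ((j : ℕ) + 1) = 0 := by
    rw [Fin.sum_univ_eq_sum_range (fun j => (-1 : ℤ) ^ (j + 1))]
    simp only [pow_succ, ← Finset.sum_mul, neg_one_geom_sum]
    simp [hn.add_one]
  rw [barOne, barD_single_aux]
  simp only [c, ← Finset.sum_smul, z, zero_smul, add_zero, barOne]

/-- Let `G` be a finite abelian group and `n = m + 1` an odd positive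
integer. For every cycle `C` in degree `n` of the unnormalized bar complex of `G` with
trivial `ℤ`-coefficients, there exist a positive integer `r` and a chain `u` in degree
`n + 1` such that `d u = r • C − (r · ε(C)) • e_n`. -/
theorem bar_cycle_torsion_boundary
    (G : Type*) [CommGroup G] [Fintype G] (m : ℕ) (hodd : Odd (m + 1))
    (C : (Fin (m + 1) → G) →₀ ℤ) (hC : barD G m C = 0) :
    ∃ (r : ℕ) (u : (Fin (m + 2) → G) →₀ ℤ), 0 < r ∧
      barD G (m + 1) u = (r : ℤ) • C - ((r : ℤ) * barEps C) • barOne G (m + 1) := by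
  refine ⟨Fintype.card G, barS G (m + 1) C
    - ((Fintype.card G : ℤ) * barEps C) • barOne G (m + 2), Fintype.card_pos, ?_⟩
  have h := bar_homotopy_aux G m C
  rw [hC, map_zero, add_zero] at h
  rw [map_sub, map_smul, h, barD_one_aux G (m + 1) hodd]
end

section
/- For every even integer d ≥ 2 and every integer N ≥ 5, one has (N/(2π))^d ≤ Σ_{k=1}^{N−1} (cot(πk/N))^d, where cot denotes the real cotangent function. -/
open Real Finset

/-- For every even integer `d ≥ 2` and every integer `N ≥ 5`,
`(N/(2π))^d ≤ ∑_{k=1}^{N−1} cot(πk/N)^d`. -/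
theorem cot_power_sum_lower_bound (d : ℕ) (hd : Even d) (hd2 : 2 ≤ d)
    (N : ℕ) (hN : 5 ≤ N) :
    ((N : ℝ) / (2 * π)) ^ d ≤ ∑ k ∈ Finset.Icc 1 (N - 1), Real.cot (π * k / N) ^ d := by
  have hN' : (5 : ℝ) ≤ N := by exact_mod_cast hN
  have hNpos : (0 : ℝ) < N := by linarith
  have hpi := Real.pi_pos
  have hx0 : 0 < π / N := by positivity
  have hx1 : π / N ≤ π / 3 := by
    apply div_le_div_of_nonneg_left hpi.le (by norm_num) (by linarith)
  have hcos : 1 / 2 ≤ Real.cos (π / N) := by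
    rw [← Real.cos_pi_div_three]
    exact Real.cos_le_cos_of_nonneg_of_le_pi hx0.le (by linarith) hx1
  have hsin : 0 < Real.sin (π / N) := Real.sin_pos_of_pos_of_lt_pi hx0 (by linarith)
  have hlt := Real.sin_lt hx0
  have key : (N : ℝ) / (2 * π) ≤ Real.cot (π * (1 : ℕ) / N) := by
    have e : (N : ℝ) / (2 * π) = (1 / 2) / (π / N) := by field_simp
    rw [Nat.cast_one, mul_one, Real.cot_eq_cos_div_sin, e]
    exact div_le_div₀ (by linarith) hcos hsin hlt.le
  refine (pow_le_pow_left₀ (by positivity) key d).trans ?_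
  exact Finset.single_le_sum (f := fun k : ℕ => Real.cot (π * k / N) ^ d)
    (fun i _ => hd.pow_nonneg _) (Finset.mem_Icc.mpr ⟨le_refl 1, by omega⟩)
end

section
/- For every even integer d ≥ 2 there exists N₀ ∈ ℕ such that for all integers N ≥ N₀, (N/π)^d < Σ_{k=1}^{N−1} (cot(πk/N))^d, where cot denotes the real cotangent function. -/
open Real Finset

/-- For every even integer `d ≥ 2` there is `N₀` such that for all
integers `N ≥ N₀`, `(N/π)^d < ∑_{k=1}^{N−1} cot(πk/N)^d`. -/
theorem cot_power_sum_eventually_gt (d : ℕ) (hd : Even d) (hd2 : 2 ≤ d) :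
    ∃ N₀ : ℕ, ∀ N : ℕ, N₀ ≤ N →
      ((N : ℝ) / π) ^ d < ∑ k ∈ Finset.Icc 1 (N - 1), Real.cot (π * k / N) ^ d := by
  have h1 : Filter.Tendsto (fun N : ℕ => 2 * Real.cos (π / N) ^ d) Filter.atTop (nhds 2) := by
    have h0 : Filter.Tendsto (fun N : ℕ => π / (N : ℝ)) Filter.atTop (nhds 0) :=
      tendsto_const_div_atTop_nhds_zero_nat π
    have hc : Continuous (fun x : ℝ => 2 * Real.cos x ^ d) := by fun_prop
    have := (hc.tendsto 0).comp h0
    simpa [Function.comp_def] using this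
  have h2 := h1.eventually (lt_mem_nhds (show (1 : ℝ) < 2 by norm_num))
  obtain ⟨M, hM⟩ := Filter.eventually_atTop.1 h2
  refine ⟨max M 3, fun N hN => ?_⟩
  have hNM := hM N (le_trans (le_max_left _ _) hN)
  have hN3 : 3 ≤ N := le_trans (le_max_right _ _) hN
  have hN3' : (3 : ℝ) ≤ N := by exact_mod_cast hN3
  have hNpos : (0 : ℝ) < N := by linarith
  set x : ℝ := π / N with hx
  have hxpos : 0 < x := div_pos pi_pos hNpos
  have hxlt : x < π / 2 := by
    rw [hx]; exact div_lt_div_of_pos_left pi_pos (by norm_num) (by linarith)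
  have hsin : 0 < Real.sin x := sin_pos_of_pos_of_lt_pi hxpos (by linarith [pi_pos])
  have hcos : 0 < Real.cos x := cos_pos_of_mem_Ioo ⟨by linarith, hxlt⟩
  have hinv : (N : ℝ) / π = 1 / x := by rw [hx, one_div_div]
  have hcot : Real.cos x / x ≤ Real.cot x := by
    rw [Real.cot_eq_cos_div_sin]
    exact div_le_div_of_nonneg_left hcos.le hsin (sin_le hxpos.le)
  have hpair : ∑ k ∈ ({1, N - 1} : Finset ℕ), Real.cot (π * k / N) ^ d
      ≤ ∑ k ∈ Finset.Icc 1 (N - 1), Real.cot (π * k / N) ^ d := by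
    apply Finset.sum_le_sum_of_subset_of_nonneg
    · intro k hk
      simp only [Finset.mem_insert, Finset.mem_singleton] at hk
      rw [Finset.mem_Icc]; omega
    · intro k _ _
      exact hd.pow_nonneg _
  refine lt_of_lt_of_le ?_ hpair
  rw [Finset.sum_pair (by omega)]
  have e1 : π * ((1 : ℕ) : ℝ) / N = x := by simp [hx]
  have e2 : π * ((N - 1 : ℕ) : ℝ) / N = π - x := by
    rw [hx, Nat.cast_sub (by omega)]; push_cast; field_simp
  have e3 : Real.cot (π - x) = - Real.cot x := by
    rw [Real.cot_eq_cos_div_sin, Real.cot_eq_cos_div_sin, cos_pi_sub, sin_pi_sub, neg_div]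
  rw [e1, e2, e3, hd.neg_pow, hinv]
  have h3 : (Real.cos x / x) ^ d ≤ Real.cot x ^ d :=
    pow_le_pow_left₀ (div_pos hcos hxpos).le hcot d
  have h4 : (1 / x) ^ d < 2 * (Real.cos x / x) ^ d := by
    rw [div_pow 1 x, div_pow (Real.cos x) x, one_pow, ← mul_div_assoc]
    exact div_lt_div_of_pos_right hNM (pow_pos hxpos d)
  linarith
end
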